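/- For every n ≥ 1, the following identity holds in F, where every complete homogeneous symmetric polynomial h_m below is evaluated at the 2n quantities (u X_1, …, u X_n, v X_1^{−1}, …, v X_n^{−1}): [ det_{1 ≤ i, j ≤ n}( (u²X_i² + u w X_i)^j + (v²X_i^{−2} + v w X_i^{−1})^j ) · det_{1 ≤ i, j ≤ n}( (u²X_i² + u w X_i)^j − (v²X_i^{−2} + v w X_i^{−1})^j ) ] / [ ∏_{1 ≤ i < j ≤ n} (X_j − X_i)(u^{−1} v X_j^{−1} − u^{−1} v X_i^{−1}) · ∏_{i=1}^{n} ∏_{j=1}^{n} (u^{−1} v X_j^{−1} − X_i) ] = ((−1)^n · u^{n² + binom(n,2)} · v^{−binom(n,2)} / 2) · det_{1 ≤ i, j ≤ n}( Σ_{k=j}^{2j} binom(j, k−j) w^{2j−k} ( h_{k−i+1} − u^{n−i+1} v^{n−i+1} h_{k+i−2n−1} ) ) · det_{1 ≤ i, j ≤ n}( Σ_{k=j}^{2j} binom(j, k−j) w^{2j−k} ( h_{k+i−n−1} + u^{i−1} v^{i−1} h_{k−i−n+1} ) ). -/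

import Mathlib

noncomputable section

/-- Complete homogeneous symmetric polynomial of degree `m` evaluated at the list `l`. -/
def hpow {R : Type*} [CommSemiring R] : ℕ → List R → R
  | 0, _ => 1
  | _ + 1, [] => 0
  | m + 1, x :: xs => hpow (m + 1) xs + x * hpow m (x :: xs)
  termination_by m l => m + l.length

/-- `h_m` with integer degree: zero for negative degrees. -/
def hz {R : Type*} [CommSemiring R] (m : ℤ) (l : List R) : R :=
  if m < 0 then 0 else hpow m.toNat l

/-- Elementary symmetric polynomial of degree `m` evaluated at the list `l`;
zero for `m` larger than the length of `l`. -/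
def epow {R : Type*} [CommSemiring R] : ℕ → List R → R
  | 0, _ => 1
  | _ + 1, [] => 0
  | m + 1, x :: xs => epow (m + 1) xs + x * epow m xs

/-- `e_m` with integer degree: zero for negative degrees. -/
def ez {R : Type*} [CommSemiring R] (m : ℤ) (l : List R) : R :=
  if m < 0 then 0 else epow m.toNat l

/-- The field `F = ℚ(u, v, w, X_1, …, X_n)` of rational functions. -/
abbrev Fld (n : ℕ) : Type := FractionRing (MvPolynomial (Fin n ⊕ Fin 3) ℚ)

/-- The indeterminate `u`. -/
def uu (n : ℕ) : Fld n :=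
  algebraMap (MvPolynomial (Fin n ⊕ Fin 3) ℚ) (Fld n) (MvPolynomial.X (Sum.inr 0))

/-- The indeterminate `v`. -/
def vv (n : ℕ) : Fld n :=
  algebraMap (MvPolynomial (Fin n ⊕ Fin 3) ℚ) (Fld n) (MvPolynomial.X (Sum.inr 1))

/-- The indeterminate `w`. -/
def wP (n : ℕ) : Fld n :=
  algebraMap (MvPolynomial (Fin n ⊕ Fin 3) ℚ) (Fld n) (MvPolynomial.X (Sum.inr 2))

/-- The indeterminate `X_i` (here `i : Fin n` corresponds to `X_{i+1}`). -/
def XP {n : ℕ} (i : Fin n) : Fld n :=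
  algebraMap (MvPolynomial (Fin n ⊕ Fin 3) ℚ) (Fld n) (MvPolynomial.X (Sum.inl i))

/-- The `2n` quantities `(u X_1, …, u X_n, v X_1^{−1}, …, v X_n^{−1})`. -/
def bigArgs (n : ℕ) : List (Fld n) :=
  ((List.finRange n).map fun i => uu n * XP i) ++ ((List.finRange n).map fun i => vv n * (XP i)⁻¹)

/-- `h_m(u X_1, …, u X_n, v X_1^{−1}, …, v X_n^{−1})`. -/
def Hn (n : ℕ) (m : ℤ) : Fld n := hz m (bigArgs n)

section JacobiTrudi

open Polynomial

/-- The generating series `∑ hpow m l * X ^ m`. -/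
def hpowSeries {K : Type*} [CommSemiring K] (l : List K) : PowerSeries K :=
  PowerSeries.mk fun m => hpow m l

theorem hpowSeries_mul_prod {K : Type*} [CommRing K] (l : List K) :
    hpowSeries l * (l.map fun x => 1 - PowerSeries.C x * PowerSeries.X).prod = 1 := by
  induction l with
  | nil =>
    ext m
    cases m <;> simp [hpowSeries, hpow, PowerSeries.coeff_one]
  | cons x xs ih =>
    have h : hpowSeries (x :: xs) * (1 - PowerSeries.C x * PowerSeries.X) = hpowSeries xs := by
      ext m
      rw [mul_sub, mul_one, mul_left_comm, ← mul_assoc]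
      cases m with
      | zero => simp [hpowSeries, hpow]
      | succ m =>
        rw [map_sub, PowerSeries.coeff_succ_mul_X]
        simp only [hpowSeries, PowerSeries.coeff_C_mul, PowerSeries.coeff_mk]
        rw [hpow]
        ring
    rw [List.map_cons, List.prod_cons, ← mul_assoc, h, ih]

theorem mk_pow_mul_one_sub {K : Type*} [CommRing K] (x : K) :
    PowerSeries.mk (fun k => x ^ k) * (1 - PowerSeries.C x * PowerSeries.X) = 1 := by
  ext m
  rw [mul_sub, mul_one, mul_left_comm, ← mul_assoc]
  cases m with
  | zero => simp
  | succ m =>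
    rw [map_sub, PowerSeries.coeff_succ_mul_X]
    simp [PowerSeries.coeff_one, pow_succ']

theorem coeff_hpowSeries_mul_X_pow {K : Type*} [CommRing K] (l : List K) (k m : ℕ) :
    PowerSeries.coeff k (hpowSeries l * PowerSeries.X ^ m) = hz ((k : ℤ) - m) l := by
  rw [PowerSeries.coeff_mul_X_pow', hz]
  by_cases h : m ≤ k
  · rw [if_pos h, if_neg (by omega), hpowSeries, PowerSeries.coeff_mk]
    congr 1
    omega
  · rw [if_neg h, if_pos (by omega)]

/-- `X ^ (N - r) + c ^ r * X ^ (N + r)`. -/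
def symPoly {K : Type*} [CommRing K] (c : K) (N r : ℕ) : K[X] :=
  X ^ (N - r) + C (c ^ r) * X ^ (N + r)

/-- `X ^ i - c ^ (n - i) * X ^ (2 * n - i)`. -/
def antisymPoly {K : Type*} [CommRing K] (c : K) (n i : ℕ) : K[X] :=
  X ^ i - C (c ^ (n - i)) * X ^ (2 * n - i)

theorem mul_symPoly_mem_span {K : Type*} [Field K] (s c : K) (N r : ℕ) (hr : r ≤ N) :
    (1 - C s * X + C c * X ^ 2) * symPoly c N r ∈
      Submodule.span K (symPoly c (N + 1) '' Set.Iic (N + 1)) := by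
  have mem : ∀ q, q ≤ N + 1 → symPoly c (N + 1) q ∈
      Submodule.span K (symPoly c (N + 1) '' Set.Iic (N + 1)) := fun q hq =>
    Submodule.subset_span ⟨q, hq, rfl⟩
  have hX : X * symPoly c N r = symPoly c (N + 1) r := by
    simp only [symPoly, show N + 1 - r = N - r + 1 by omega]
    ring
  have key : (1 - C s * X + C c * X ^ 2) * symPoly c N r =
      (1 + C c * X ^ 2) * symPoly c N r - s • symPoly c (N + 1) r := by
    rw [← hX, Polynomial.smul_eq_C_mul]
    ring
  rw [key]
  refine Submodule.sub_mem _ ?_ (Submodule.smul_mem _ _ (mem r (by omega)))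
  cases r with
  | zero =>
    have : (1 + C c * X ^ 2) * symPoly c N 0 = (2 : K) • symPoly c (N + 1) 1 := by
      simp only [symPoly, Polynomial.smul_eq_C_mul, C_ofNat, Nat.sub_zero, pow_zero, C_1,
        Nat.add_sub_cancel]
      simp
      ring
    rw [this]
    exact Submodule.smul_mem _ _ (mem 1 (by omega))
  | succ r =>
    have : (1 + C c * X ^ 2) * symPoly c N (r + 1) =
        symPoly c (N + 1) (r + 2) + c • symPoly c (N + 1) r := by
      obtain ⟨M, rfl⟩ : ∃ M, N = M + (r + 1) := ⟨N - (r + 1), by omega⟩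
      simp only [symPoly, Polynomial.smul_eq_C_mul, show M + (r + 1) + 1 - (r + 2) = M by omega,
        show M + (r + 1) - (r + 1) = M by omega, show M + (r + 1) + 1 - r = M + 2 by omega, C_pow]
      ring
    rw [this]
    exact Submodule.add_mem _ (mem _ (by omega)) (Submodule.smul_mem _ _ (mem _ (by omega)))

theorem prod_mem_span_symPoly {K ι : Type*} [Field K] (h2 : (2 : K) ≠ 0) (s : ι → K) (c : K)
    (S : Finset ι) :
    ∏ l ∈ S, (1 - C (s l) * X + C c * X ^ 2) ∈
      Submodule.span K (symPoly c S.card '' Set.Iic S.card) := by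
  classical
  induction S using Finset.induction_on with
  | empty =>
    have : (1 : K[X]) = (2 : K)⁻¹ • symPoly c 0 0 := by
      simp only [symPoly, Polynomial.smul_eq_C_mul]
      rw [show (X ^ (0 - 0) + C (c ^ 0) * X ^ (0 + 0) : K[X]) = C 2 by
        simp [one_add_one_eq_two, C_ofNat], ← C_mul, inv_mul_cancel₀ h2, C_1]
    rw [Finset.prod_empty, this]
    exact Submodule.smul_mem _ _ (Submodule.subset_span ⟨0, by simp, by simp⟩)
  | insert i S hi ih =>
    rw [Finset.prod_insert hi, Finset.card_insert_of_notMem hi]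
    generalize ∏ l ∈ S, (1 - C (s l) * X + C c * X ^ 2) = q at ih ⊢
    induction ih using Submodule.span_induction with
    | mem x hx =>
      obtain ⟨r, hr, rfl⟩ := hx
      exact mul_symPoly_mem_span _ _ _ _ hr
    | zero => simp
    | add x y _ _ hx hy => rw [mul_add]; exact Submodule.add_mem _ hx hy
    | smul t x _ hx => rw [mul_smul_comm]; exact Submodule.smul_mem _ _ hx

theorem mul_symPoly_mem_span_antisymPoly {K : Type*} [Field K] (c : K) (N r : ℕ) (hr : r ≤ N) :
    (1 - C c * X ^ 2) * symPoly c N r ∈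
      Submodule.span K (antisymPoly c (N + 1) '' Set.Iic N) := by
  have mem : ∀ q, q ≤ N → antisymPoly c (N + 1) q ∈
      Submodule.span K (antisymPoly c (N + 1) '' Set.Iic N) := fun q hq =>
    Submodule.subset_span ⟨q, hq, rfl⟩
  obtain ⟨M, rfl⟩ : ∃ M, N = M + r := ⟨N - r, by omega⟩
  rcases r with _ | _ | r
  · have : (1 - C c * X ^ 2) * symPoly c (M + 0) 0 = (2 : K) • antisymPoly c (M + 0 + 1) M := by
      simp only [symPoly, antisymPoly, Polynomial.smul_eq_C_mul, C_ofNat,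
        show M + 0 + 1 - M = 1 by omega, show 2 * (M + 0 + 1) - M = M + 2 by omega]
      simp
      ring
    rw [this]
    exact Submodule.smul_mem _ _ (mem _ (by omega))
  · have : (1 - C c * X ^ 2) * symPoly c (M + (0 + 1)) (0 + 1) =
        antisymPoly c (M + (0 + 1) + 1) M := by
      simp only [symPoly, antisymPoly, show M + (0 + 1) + 1 - M = 2 by omega,
        show 2 * (M + (0 + 1) + 1) - M = M + 4 by omega, C_pow]
      simp
      ring
    rw [this]
    exact mem _ (by omega)
  · have : (1 - C c * X ^ 2) * symPoly c (M + (r + 1 + 1)) (r + 1 + 1) =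
        antisymPoly c (M + (r + 1 + 1) + 1) M - c • antisymPoly c (M + (r + 1 + 1) + 1) (M + 2) := by
      simp only [symPoly, antisymPoly, Polynomial.smul_eq_C_mul,
        show M + (r + 1 + 1) + 1 - M = r + 3 by omega,
        show M + (r + 1 + 1) + 1 - (M + 2) = r + 1 by omega,
        show M + (r + 1 + 1) - (r + 1 + 1) = M by omega,
        show 2 * (M + (r + 1 + 1) + 1) - M = M + 2 * r + 6 by omega,
        show 2 * (M + (r + 1 + 1) + 1) - (M + 2) = M + 2 * r + 4 by omega, C_pow]
      ring
    rw [this]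
    exact Submodule.sub_mem _ (mem _ (by omega)) (Submodule.smul_mem _ _ (mem _ (by omega)))

theorem mul_mem_span_antisymPoly {K : Type*} [Field K] {c : K} {N : ℕ} {q : K[X]}
    (hq : q ∈ Submodule.span K (symPoly c N '' Set.Iic N)) :
    (1 - C c * X ^ 2) * q ∈ Submodule.span K (antisymPoly c (N + 1) '' Set.Iic N) := by
  induction hq using Submodule.span_induction with
  | mem x hx =>
    obtain ⟨r, hr, rfl⟩ := hx
    exact mul_symPoly_mem_span_antisymPoly _ _ _ hr
  | zero => simp
  | add x y _ _ hx hy => rw [mul_add]; exact Submodule.add_mem _ hx hy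
  | smul t x _ hx => rw [mul_smul_comm]; exact Submodule.smul_mem _ _ hx

theorem exists_fin_sum_of_mem_span_image_Iic {K V : Type*} [Field K] [AddCommGroup V] [Module K V]
    {f : ℕ → V} {N : ℕ} {q : V} (hq : q ∈ Submodule.span K (f '' Set.Iic N)) :
    ∃ d : Fin (N + 1) → K, q = ∑ r, d r • f r := by
  have : f '' Set.Iic N = Set.range fun r : Fin (N + 1) => f r := by
    ext x
    constructor
    · rintro ⟨r, hr, rfl⟩
      exact ⟨⟨r, Nat.lt_succ_of_le hr⟩, rfl⟩
    · rintro ⟨r, rfl⟩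
      exact ⟨r, Nat.le_of_lt_succ r.2, rfl⟩
  rw [this, Submodule.mem_span_range_iff_exists_fun] at hq
  obtain ⟨d, hd⟩ := hq
  exact ⟨d, hd.symm⟩

theorem eval_inv_symPoly {K : Type*} [Field K] {a b c : K} (hab : a * b = c) (ha : a ≠ 0)
    {N r : ℕ} (hr : r ≤ N) :
    (symPoly c N r).eval a⁻¹ = (a ^ N)⁻¹ * (a ^ r + b ^ r) := by
  obtain ⟨M, rfl⟩ : ∃ M, N = M + r := ⟨N - r, by omega⟩
  subst hab
  simp only [symPoly, Nat.add_sub_cancel, eval_add, eval_mul, eval_pow, eval_X, eval_C]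
  simp only [inv_pow]
  field_simp
  ring

theorem eval_inv_antisymPoly {K : Type*} [Field K] {a b c : K} (hab : a * b = c) (ha : a ≠ 0)
    {n i : ℕ} (hi : i ≤ n) :
    (antisymPoly c n i).eval a⁻¹ = (a ^ n)⁻¹ * (a ^ (n - i) - b ^ (n - i)) := by
  obtain ⟨M, rfl⟩ : ∃ M, n = i + M := ⟨n - i, by omega⟩
  subst hab
  simp only [antisymPoly, Nat.add_sub_cancel_left, show 2 * (i + M) - i = i + 2 * M by omega,
    eval_sub, eval_mul, eval_pow, eval_X, eval_C]
  simp only [inv_pow]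
  field_simp
  ring

theorem dickson_succ_natDegree_monic {K : Type*} [Field K] (k : ℕ) (c : K) (r : ℕ) :
    (dickson k c (r + 1)).natDegree = r + 1 ∧ (dickson k c (r + 1)).Monic := by
  suffices h : (dickson k c r).natDegree ≤ r ∧ (dickson k c (r + 1)).natDegree = r + 1 ∧
    (dickson k c (r + 1)).Monic from h.2
  induction r with
  | zero =>
    refine ⟨?_, by simp, by simp⟩
    have : (3 - (k : K[X])) = C (3 - (k : K)) := by simp [C_ofNat]
    rw [dickson_zero, this, natDegree_C]
  | succ r ih =>
    obtain ⟨h, hd, hm⟩ := ih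
    have hd' : (X * dickson k c (r + 1)).natDegree = r + 2 := by
      rw [monic_X.natDegree_mul hm, natDegree_X, hd]; ring
    have hlt : (C c * dickson k c r).natDegree < (X * dickson k c (r + 1)).natDegree := by
      rw [hd']
      exact lt_of_le_of_lt (natDegree_C_mul_le _ _) (by omega)
    rw [dickson_add_two]
    refine ⟨hd.le, ?_, (monic_X.mul hm).sub_of_left (degree_lt_degree hlt)⟩
    rw [natDegree_sub_eq_left_of_natDegree_lt hlt, hd']

theorem eval_dickson_one {K : Type*} [Field K] {a b c : K} (hab : a * b = c) (r : ℕ) :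
    (dickson 1 c r).eval (a + b) = a ^ r + b ^ r := by
  induction r using Nat.twoStepInduction with
  | zero => simp; norm_num
  | one => simp
  | more r ih ih' =>
    rw [dickson_add_two, eval_sub, eval_mul, eval_mul, eval_X, eval_C, ih', ih, ← hab]
    ring

theorem sub_mul_eval_dickson_two {K : Type*} [Field K] {a b c : K} (hab : a * b = c) (r : ℕ) :
    (a - b) * (dickson 2 c r).eval (a + b) = a ^ (r + 1) - b ^ (r + 1) := by
  induction r using Nat.twoStepInduction with
  | zero => simp; norm_num
  | one => simp; ring
  | more r ih ih' =>
    rw [dickson_add_two, eval_sub, eval_mul, eval_mul, eval_X, eval_C, mul_sub, mul_left_comm, ih',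
      mul_left_comm, ih, ← hab]
    ring

theorem det_pow_add_pow {K : Type*} [Field K] {N : ℕ} {c : K} (a b : Fin (N + 1) → K)
    (hab : ∀ i, a i * b i = c) :
    (Matrix.of fun i j : Fin (N + 1) => a i ^ (j : ℕ) + b i ^ (j : ℕ)).det =
      2 * (Matrix.vandermonde fun i => a i + b i).det := by
  rw [Matrix.det_eval_matrixOfPolynomials_eq_det_vandermonde (fun i => a i + b i)
    (fun j => if j = 0 then 1 else dickson 1 c j)]
  · have h : (∏ j : Fin (N + 1), if j = 0 then (2 : K) else 1) = 2 := by simp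
    conv_rhs => rw [← h, ← Matrix.det_mul_row]
    congr 1
    ext i j
    simp only [Matrix.of_apply]
    split_ifs with hj
    · subst hj; simp; norm_num
    · rw [one_mul, eval_dickson_one (hab i)]
  · intro j
    split_ifs with hj
    · simp [hj]
    · obtain ⟨m, hm⟩ := Nat.exists_eq_succ_of_ne_zero (Fin.val_ne_zero_iff.mpr hj)
      rw [hm]
      exact (dickson_succ_natDegree_monic 1 c m).1
  · intro j
    split_ifs with hj
    · exact monic_one
    · obtain ⟨m, hm⟩ := Nat.exists_eq_succ_of_ne_zero (Fin.val_ne_zero_iff.mpr hj)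
      rw [hm]
      exact (dickson_succ_natDegree_monic 1 c m).2

theorem det_pow_sub_pow {K : Type*} [Field K] {n : ℕ} {c : K} (a b : Fin n → K)
    (hab : ∀ i, a i * b i = c) :
    (Matrix.of fun i j : Fin n => a i ^ ((j : ℕ) + 1) - b i ^ ((j : ℕ) + 1)).det =
      (∏ i, (a i - b i)) * (Matrix.vandermonde fun i => a i + b i).det := by
  have h0 : dickson 2 c 0 = 1 := by rw [dickson_zero]; norm_num
  rw [Matrix.det_eval_matrixOfPolynomials_eq_det_vandermonde (fun i => a i + b i)
    (fun j => dickson 2 c j)]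
  · rw [← Matrix.det_mul_column]
    congr 1
    ext i j
    simp only [Matrix.of_apply]
    rw [sub_mul_eval_dickson_two (hab i)]
  · intro j
    cases hj : (j : ℕ) with
    | zero => simp [h0]
    | succ m => exact (dickson_succ_natDegree_monic 2 c m).1
  · intro j
    cases hj : (j : ℕ) with
    | zero => rw [h0]; exact monic_one
    | succ m => exact (dickson_succ_natDegree_monic 2 c m).2

/-- The product of `1 - s l * X + c * X ^ 2` over all indices `l ≠ i`. -/
def omitProd {K ι : Type*} [Field K] [Fintype ι] [DecidableEq ι] (s : ι → K) (c : K) (i : ι) :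
    K[X] :=
  ∏ l ∈ {i}ᶜ, (1 - C (s l) * X + C c * X ^ 2)

theorem eval_inv_omitProd {K ι : Type*} [Field K] [Fintype ι] [DecidableEq ι] {c : K} {a b : ι → K}
    (hab : ∀ i, a i * b i = c) (ha : ∀ i, a i ≠ 0) (i j : ι) :
    a j ^ (Fintype.card ι - 1) * (omitProd (fun l => a l + b l) c i).eval (a j)⁻¹ =
      if i = j then ∏ l ∈ {i}ᶜ, (a i + b i - (a l + b l)) else 0 := by
  have hcard : Fintype.card ι - 1 = ({i}ᶜ : Finset ι).card := by
    rw [Finset.card_compl, Finset.card_singleton]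
  have h : a j ^ (Fintype.card ι - 1) * (omitProd (fun l => a l + b l) c i).eval (a j)⁻¹ =
      ∏ l ∈ {i}ᶜ, (a j + b j - (a l + b l)) := by
    rw [hcard, omitProd, eval_prod, ← Finset.prod_const, ← Finset.prod_mul_distrib]
    refine Finset.prod_congr rfl fun l _ => ?_
    have := ha j
    simp only [eval_add, eval_sub, eval_one, eval_mul, eval_C, eval_X, eval_pow, ← hab j]
    field_simp
    ring
  rw [h]
  split_ifs with hij
  · rw [hij]
  · exact Finset.prod_eq_zero (i := j) (by simpa using Ne.symm hij) (sub_self _)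

theorem det_pow_sub_pow_rev {K : Type*} [Field K] {N : ℕ} {c : K} (a b : Fin (N + 1) → K)
    (hab : ∀ i, a i * b i = c) :
    (Matrix.of fun r j : Fin (N + 1) =>
        a j ^ (N + 1 - (r : ℕ)) - b j ^ (N + 1 - (r : ℕ))).det =
      (∏ i, (a i - b i)) * ∏ i : Fin (N + 1), ∏ j ∈ Finset.Ioi i, (a i + b i - (a j + b j)) := by
  have h1 := det_pow_sub_pow (a ∘ Fin.rev) (b ∘ Fin.rev) (c := c) fun i => hab _
  rw [← Matrix.det_submatrix_equiv_self Fin.revPerm, ← Matrix.det_transpose] at h1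
  have h2 : (Matrix.vandermonde fun i => (a ∘ Fin.rev) i + (b ∘ Fin.rev) i).det =
      ∏ i : Fin (N + 1), ∏ j ∈ Finset.Ioi i, (a i + b i - (a j + b j)) := by
    rw [← Matrix.det_submatrix_equiv_self Fin.revPerm]
    have : (Matrix.vandermonde fun i => (a ∘ Fin.rev) i + (b ∘ Fin.rev) i).submatrix
        Fin.revPerm Fin.revPerm = Matrix.projVandermonde 1 fun i => a i + b i := by
      ext i j
      simp [Matrix.projVandermonde_apply, Matrix.vandermonde_apply]
    rw [this, Matrix.det_projVandermonde]
    simp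
  have h3 : ∏ i, ((a ∘ Fin.rev) i - (b ∘ Fin.rev) i) = ∏ i, (a i - b i) :=
    Equiv.prod_comp Fin.revPerm fun i => a i - b i
  rw [h2, h3] at h1
  rw [← h1]
  congr 1
  ext r j
  simp only [Matrix.of_apply, Matrix.transpose_apply, Matrix.submatrix_apply, Function.comp,
    Fin.revPerm_apply, Fin.rev_rev, Fin.val_rev]
  rw [show N + 1 - ((r : ℕ) + 1) + 1 = N + 1 - r by omega]

theorem two_mul_det_mul_det {K : Type*} [Field K] {N : ℕ} {c : K} {a b : Fin (N + 1) → K}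
    (hab : ∀ i, a i * b i = c) (ha : ∀ i, a i ≠ 0) (hne : ∀ i, a i ≠ b i)
    (hs : Function.Injective fun i => a i + b i) (d e : Matrix (Fin (N + 1)) (Fin (N + 1)) K)
    (hd : ∀ i, (1 - C c * X ^ 2) * omitProd (fun l => a l + b l) c i =
      ∑ r, d i r • antisymPoly c (N + 1) r)
    (he : ∀ i, omitProd (fun l => a l + b l) c i = ∑ r, e i r • symPoly c N r) :
    2 * (d.det * e.det) =
      ∏ i : Fin (N + 1), ∏ j ∈ Finset.Ioi i,
        ((a j + b j - (a i + b i)) * (a i + b i - (a j + b j))) := by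
  have hQ := eval_inv_omitProd hab ha
  simp only [Fintype.card_fin, Nat.add_sub_cancel] at hQ
  have h1 : e * (Matrix.of fun i j : Fin (N + 1) => a i ^ (j : ℕ) + b i ^ (j : ℕ)).transpose =
      Matrix.diagonal fun i => ∏ l ∈ {i}ᶜ, (a i + b i - (a l + b l)) := by
    ext i j
    rw [Matrix.diagonal_apply, ← hQ i j, he i, Matrix.mul_apply, eval_finsetSum, Finset.mul_sum]
    refine Finset.sum_congr rfl fun r _ => ?_
    have := pow_ne_zero N (ha j)
    rw [eval_smul, eval_inv_symPoly (hab j) (ha j) (Nat.le_of_lt_succ r.2), smul_eq_mul,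
      Matrix.transpose_apply, Matrix.of_apply]
    field_simp
  have h2 : d * (Matrix.of fun r j : Fin (N + 1) =>
        a j ^ (N + 1 - (r : ℕ)) - b j ^ (N + 1 - (r : ℕ))) =
      Matrix.diagonal fun i => (a i - b i) * ∏ l ∈ {i}ᶜ, (a i + b i - (a l + b l)) := by
    ext i j
    have h : a j ^ (N + 1) *
        ((1 - C c * X ^ 2) * omitProd (fun l => a l + b l) c i).eval (a j)⁻¹ =
        (a j - b j) * if i = j then ∏ l ∈ {i}ᶜ, (a i + b i - (a l + b l)) else 0 := by
      rw [← hQ i j, eval_mul, pow_succ]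
      have := ha j
      simp only [eval_sub, eval_one, eval_mul, eval_C, eval_X, eval_pow, ← hab j]
      field_simp
    have h' : (Matrix.diagonal fun i => (a i - b i) *
        ∏ l ∈ {i}ᶜ, (a i + b i - (a l + b l))) i j = a j ^ (N + 1) *
        ((1 - C c * X ^ 2) * omitProd (fun l => a l + b l) c i).eval (a j)⁻¹ := by
      rw [h, Matrix.diagonal_apply]
      split_ifs with hij
      · rw [hij]
      · rw [mul_zero]
    rw [h', hd i, Matrix.mul_apply, eval_finsetSum, Finset.mul_sum]
    refine Finset.sum_congr rfl fun r _ => ?_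
    have := pow_ne_zero (N + 1) (ha j)
    rw [eval_smul, eval_inv_antisymPoly (hab j) (ha j) r.2.le, smul_eq_mul, Matrix.of_apply]
    field_simp
  have h1' := congrArg Matrix.det h1
  have h2' := congrArg Matrix.det h2
  rw [Matrix.det_mul, Matrix.det_diagonal, Matrix.det_transpose, det_pow_add_pow a b hab,
    Matrix.det_vandermonde] at h1'
  rw [Matrix.det_mul, Matrix.det_diagonal, det_pow_sub_pow_rev a b hab,
    Finset.prod_mul_distrib] at h2'
  have hR := Finset.prod_prod_Ioi_mul_eq_prod_prod_off_diag
    fun i j : Fin (N + 1) => (a j + b j - (a i + b i))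
  have hR0 : ∏ i : Fin (N + 1), ∏ l ∈ {i}ᶜ, (a i + b i - (a l + b l)) ≠ 0 := by
    refine Finset.prod_ne_zero_iff.mpr fun i _ => Finset.prod_ne_zero_iff.mpr fun l hl => ?_
    rw [sub_ne_zero]
    exact fun h => (by simpa using hl : l ≠ i) (hs h).symm
  have hP0 : ∏ i, (a i - b i) ≠ 0 := Finset.prod_ne_zero_iff.mpr fun i _ => sub_ne_zero.mpr (hne i)
  have h3 : ∏ i : Fin (N + 1), ∏ j ∈ Finset.Ioi i,
        ((a j + b j - (a i + b i)) * (a i + b i - (a j + b j))) =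
      ∏ i : Fin (N + 1), ∏ l ∈ {i}ᶜ, (a i + b i - (a l + b l)) := by
    rw [← hR]
    exact Finset.prod_congr rfl fun i _ => Finset.prod_congr rfl fun j _ => mul_comm _ _
  rw [h3]
  have h4 := h3
  simp only [Finset.prod_mul_distrib] at h4
  set R := ∏ i : Fin (N + 1), ∏ l ∈ {i}ᶜ, (a i + b i - (a l + b l))
  apply mul_right_cancel₀ (mul_ne_zero hP0 hR0)
  calc _ = (2 * (d.det * e.det)) * ((∏ i, (a i - b i)) * (_ * _)) := by rw [← h4]
    _ = _ := by linear_combination congrArg₂ (· * ·) h1' h2'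

theorem hpowSeries_mul_omitProd {K ι : Type*} [Field K] [Fintype ι] [DecidableEq ι] {c : K}
    {a b : ι → K} (hab : ∀ i, a i * b i = c) {l : List K}
    (hl : hpowSeries l * ∏ i, ((1 - PowerSeries.C (a i) * PowerSeries.X) *
      (1 - PowerSeries.C (b i) * PowerSeries.X)) = 1) (i : ι) :
    hpowSeries l * (omitProd (fun l => a l + b l) c i : PowerSeries K) *
      ((1 - PowerSeries.C (a i) * PowerSeries.X) *
        (1 - PowerSeries.C (b i) * PowerSeries.X)) = 1 := by
  refine Eq.trans ?_ hl
  rw [Fintype.prod_eq_prod_compl_mul i, mul_assoc]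
  congr 2
  rw [omitProd, ← Polynomial.coeToPowerSeries.ringHom_apply, map_prod]
  refine Finset.prod_congr rfl fun l _ => ?_
  rw [← hab l]
  simp only [map_add, map_sub, map_mul, map_one, map_pow,
    Polynomial.coeToPowerSeries.ringHom_apply, Polynomial.coe_C, Polynomial.coe_X]
  ring

theorem mk_pow_sub_mk_pow {K ι : Type*} [Field K] [Fintype ι] [DecidableEq ι] {c : K}
    {a b : ι → K} (hab : ∀ i, a i * b i = c) {l : List K}
    (hl : hpowSeries l * ∏ i, ((1 - PowerSeries.C (a i) * PowerSeries.X) *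
      (1 - PowerSeries.C (b i) * PowerSeries.X)) = 1) (i : ι) :
    PowerSeries.mk (fun k => a i ^ k) - PowerSeries.mk (fun k => b i ^ k) =
      PowerSeries.C (a i - b i) * (hpowSeries l *
        ((X * omitProd (fun l => a l + b l) c i : K[X]) : PowerSeries K)) := by
  have h := hpowSeries_mul_omitProd hab hl i
  rw [Polynomial.coe_mul, Polynomial.coe_X, map_sub]
  generalize (omitProd (fun l => a l + b l) c i : PowerSeries K) = q at h ⊢
  have h1 := mk_pow_mul_one_sub (a i)
  have h2 := mk_pow_mul_one_sub (b i)
  set A := PowerSeries.mk (fun k => a i ^ k)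
  set B := PowerSeries.mk (fun k => b i ^ k)
  linear_combination (B - A) * h + hpowSeries l * q *
    ((1 - PowerSeries.C (b i) * PowerSeries.X) * h1 - (1 - PowerSeries.C (a i) * PowerSeries.X) * h2)

theorem mk_pow_add_mk_pow {K ι : Type*} [Field K] [Fintype ι] [DecidableEq ι] {c : K}
    {a b : ι → K} (hab : ∀ i, a i * b i = c) {l : List K}
    (hl : hpowSeries l * ∏ i, ((1 - PowerSeries.C (a i) * PowerSeries.X) *
      (1 - PowerSeries.C (b i) * PowerSeries.X)) = 1) (i : ι) :
    PowerSeries.mk (fun k => a i ^ k) + PowerSeries.mk (fun k => b i ^ k) =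
      hpowSeries l * (((1 - C c * X ^ 2) * omitProd (fun l => a l + b l) c i : K[X]) :
        PowerSeries K) + 1 := by
  have h := hpowSeries_mul_omitProd hab hl i
  rw [← Polynomial.coeToPowerSeries.ringHom_apply, map_mul, ← hab i]
  rw [← hab i] at h
  simp only [map_sub, map_mul, map_one, map_pow,
    Polynomial.coeToPowerSeries.ringHom_apply, Polynomial.coe_C, Polynomial.coe_X]
  generalize (omitProd (fun l => a l + b l) (a i * b i) i : PowerSeries K) = q at h ⊢
  have h1 := mk_pow_mul_one_sub (a i)
  have h2 := mk_pow_mul_one_sub (b i)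
  set A := PowerSeries.mk (fun k => a i ^ k)
  set B := PowerSeries.mk (fun k => b i ^ k)
  linear_combination (1 - A - B) * h + hpowSeries l * q *
    ((1 - PowerSeries.C (b i) * PowerSeries.X) * h1 + (1 - PowerSeries.C (a i) * PowerSeries.X) * h2)

theorem coeff_hpowSeries_mul_antisymPoly {K : Type*} [Field K] (c : K) (l : List K) (n i k : ℕ) :
    PowerSeries.coeff k (hpowSeries l * (antisymPoly c n i : PowerSeries K)) =
      hz ((k : ℤ) - i) l - c ^ (n - i) * hz ((k : ℤ) - (2 * n - i : ℕ)) l := by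
  rw [antisymPoly, Polynomial.coe_sub, Polynomial.coe_mul, Polynomial.coe_C, Polynomial.coe_pow,
    Polynomial.coe_pow, Polynomial.coe_X, mul_sub, mul_left_comm, map_sub, PowerSeries.coeff_C_mul,
    coeff_hpowSeries_mul_X_pow, coeff_hpowSeries_mul_X_pow]

theorem coeff_hpowSeries_mul_X_mul_symPoly {K : Type*} [Field K] (c : K) (l : List K)
    (N r k : ℕ) :
    PowerSeries.coeff k (hpowSeries l * ((X * symPoly c N r : K[X]) : PowerSeries K)) =
      hz ((k : ℤ) - (N - r + 1 : ℕ)) l + c ^ r * hz ((k : ℤ) - (N + r + 1 : ℕ)) l := by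
  have : X * symPoly c N r = X ^ (N - r + 1) + C (c ^ r) * X ^ (N + r + 1) := by
    rw [symPoly]; ring
  rw [this, Polynomial.coe_add, Polynomial.coe_mul, Polynomial.coe_C, Polynomial.coe_pow,
    Polynomial.coe_pow, Polynomial.coe_X, mul_add, mul_left_comm, map_add, PowerSeries.coeff_C_mul,
    coeff_hpowSeries_mul_X_pow, coeff_hpowSeries_mul_X_pow]

theorem sq_add_mul_pow {K : Type*} [CommRing K] (w x : K) (J : ℕ) :
    (x ^ 2 + w * x) ^ J = ∑ k ∈ Finset.Icc J (2 * J),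
      ((Nat.choose J (k - J) : K) * w ^ (2 * J - k)) * x ^ k := by
  rw [add_pow, ← Finset.Ico_add_one_right_eq_Icc, Finset.sum_Ico_eq_sum_range,
    show 2 * J + 1 - J = J + 1 by omega]
  refine Finset.sum_congr rfl fun m hm => ?_
  obtain ⟨p, rfl⟩ : ∃ p, J = m + p := ⟨J - m, by have := Finset.mem_range.mp hm; omega⟩
  rw [show m + p - m = p by omega, show m + p + m - (m + p) = m by omega,
    show 2 * (m + p) - (m + p + m) = p by omega]
  ring

theorem of_sum_eq_mul {K : Type*} [CommRing K] (w : K) {n : ℕ} {y : Fin n → ℕ → K}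
    {d : Fin n → Fin n → K} {g : Fin n → ℕ → K}
    (h : ∀ i (k : ℕ), k ≠ 0 → y i k = ∑ r, d i r * g r k) :
    (Matrix.of fun i j : Fin n => ∑ k ∈ Finset.Icc ((j : ℕ) + 1) (2 * ((j : ℕ) + 1)),
      (Nat.choose ((j : ℕ) + 1) (k - ((j : ℕ) + 1)) : K) * w ^ (2 * ((j : ℕ) + 1) - k) * y i k) =
    Matrix.of d * Matrix.of fun i j : Fin n =>
      ∑ k ∈ Finset.Icc ((j : ℕ) + 1) (2 * ((j : ℕ) + 1)),
        (Nat.choose ((j : ℕ) + 1) (k - ((j : ℕ) + 1)) : K) * w ^ (2 * ((j : ℕ) + 1) - k) *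
          g i k := by
  ext i j
  simp only [Matrix.mul_apply, Matrix.of_apply, Finset.mul_sum]
  rw [Finset.sum_comm]
  refine Finset.sum_congr rfl fun k hk => ?_
  rw [h i k (by have := (Finset.mem_Icc.mp hk).1; omega), Finset.mul_sum]
  exact Finset.sum_congr rfl fun r _ => mul_left_comm _ _ _

theorem det_add_mul_det_sub {K : Type*} [Field K] (h2 : (2 : K) ≠ 0) {N : ℕ} {c : K} (w : K)
    {a b : Fin (N + 1) → K} (hab : ∀ i, a i * b i = c) (ha : ∀ i, a i ≠ 0)
    (hne : ∀ i, a i ≠ b i) (hs : Function.Injective fun i => a i + b i) {l : List K}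
    (hl : hpowSeries l * ∏ i, ((1 - PowerSeries.C (a i) * PowerSeries.X) *
      (1 - PowerSeries.C (b i) * PowerSeries.X)) = 1) :
    (Matrix.of fun i j : Fin (N + 1) =>
        (a i ^ 2 + w * a i) ^ ((j : ℕ) + 1) + (b i ^ 2 + w * b i) ^ ((j : ℕ) + 1)).det *
      (Matrix.of fun i j : Fin (N + 1) =>
        (a i ^ 2 + w * a i) ^ ((j : ℕ) + 1) - (b i ^ 2 + w * b i) ^ ((j : ℕ) + 1)).det =
    (∏ i, (a i - b i)) * (∏ i : Fin (N + 1), ∏ j ∈ Finset.Ioi i,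
        ((a j + b j - (a i + b i)) * (a i + b i - (a j + b j)))) / 2 *
      (Matrix.of fun i j : Fin (N + 1) => ∑ k ∈ Finset.Icc ((j : ℕ) + 1) (2 * ((j : ℕ) + 1)),
        (Nat.choose ((j : ℕ) + 1) (k - ((j : ℕ) + 1)) : K) * w ^ (2 * ((j : ℕ) + 1) - k) *
          (hz ((k : ℤ) - (i : ℕ)) l -
            c ^ (N + 1 - (i : ℕ)) * hz ((k : ℤ) - (2 * (N + 1) - (i : ℕ) : ℕ)) l)).det *
      (Matrix.of fun i j : Fin (N + 1) => ∑ k ∈ Finset.Icc ((j : ℕ) + 1) (2 * ((j : ℕ) + 1)),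
        (Nat.choose ((j : ℕ) + 1) (k - ((j : ℕ) + 1)) : K) * w ^ (2 * ((j : ℕ) + 1) - k) *
          (hz ((k : ℤ) - (N - (i : ℕ) + 1 : ℕ)) l +
            c ^ (i : ℕ) * hz ((k : ℤ) - (N + (i : ℕ) + 1 : ℕ)) l)).det := by
  have hmem : ∀ i, omitProd (fun l => a l + b l) c i ∈
      Submodule.span K (symPoly c N '' Set.Iic N) := fun i => by
    have := prod_mem_span_symPoly h2 (fun l => a l + b l) c {i}ᶜ
    rwa [show ({i}ᶜ : Finset (Fin (N + 1))).card = N by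
      rw [Finset.card_compl, Finset.card_singleton, Fintype.card_fin, Nat.add_sub_cancel]] at this
  choose e he using fun i => exists_fin_sum_of_mem_span_image_Iic (hmem i)
  choose d hd using fun i =>
    exists_fin_sum_of_mem_span_image_Iic (mul_mem_span_antisymPoly (hmem i))
  have hadd : ∀ i (k : ℕ), k ≠ 0 → a i ^ k + b i ^ k = ∑ r : Fin (N + 1), d i r *
      (hz ((k : ℤ) - (r : ℕ)) l -
        c ^ (N + 1 - (r : ℕ)) * hz ((k : ℤ) - (2 * (N + 1) - (r : ℕ) : ℕ)) l) := by
    intro i k hk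
    have h := congrArg (PowerSeries.coeff k) (mk_pow_add_mk_pow hab hl i)
    rw [map_add, map_add, PowerSeries.coeff_mk, PowerSeries.coeff_mk, PowerSeries.coeff_one,
      if_neg hk, add_zero, hd i, ← Polynomial.coeToPowerSeries.ringHom_apply, map_sum,
      Finset.mul_sum, map_sum] at h
    rw [h]
    refine Finset.sum_congr rfl fun r _ => ?_
    rw [Polynomial.coeToPowerSeries.ringHom_apply, Polynomial.smul_eq_C_mul, Polynomial.coe_mul,
      Polynomial.coe_C, mul_left_comm,
      PowerSeries.coeff_C_mul, coeff_hpowSeries_mul_antisymPoly]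
  have hsub : ∀ i (k : ℕ), k ≠ 0 → a i ^ k - b i ^ k = ∑ r : Fin (N + 1), (a i - b i) * e i r *
      (hz ((k : ℤ) - (N - (r : ℕ) + 1 : ℕ)) l +
        c ^ (r : ℕ) * hz ((k : ℤ) - (N + (r : ℕ) + 1 : ℕ)) l) := by
    intro i k _
    have h := congrArg (PowerSeries.coeff k) (mk_pow_sub_mk_pow hab hl i)
    rw [map_sub, PowerSeries.coeff_mk, PowerSeries.coeff_mk, PowerSeries.coeff_C_mul, he i,
      Finset.mul_sum, ← Polynomial.coeToPowerSeries.ringHom_apply, map_sum,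
      Finset.mul_sum, map_sum] at h
    rw [h, Finset.mul_sum]
    refine Finset.sum_congr rfl fun r _ => ?_
    rw [Polynomial.coeToPowerSeries.ringHom_apply, Polynomial.smul_eq_C_mul,
      mul_left_comm X, Polynomial.coe_mul, Polynomial.coe_C, mul_left_comm (hpowSeries l),
      PowerSeries.coeff_C_mul, coeff_hpowSeries_mul_X_mul_symPoly, mul_assoc]
  have hdet := two_mul_det_mul_det hab ha hne hs (Matrix.of d) (Matrix.of e) hd he
  rw [← hdet, mul_left_comm, mul_div_cancel_left₀ _ h2]
  have hP : (Matrix.of fun i j : Fin (N + 1) => (a i ^ 2 + w * a i) ^ ((j : ℕ) + 1) +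
      (b i ^ 2 + w * b i) ^ ((j : ℕ) + 1)).det = (Matrix.of d).det * _ :=
    (congrArg Matrix.det ((Matrix.ext fun i j => by
      simp only [Matrix.of_apply, sq_add_mul_pow, ← Finset.sum_add_distrib, ← mul_add]).trans
      (of_sum_eq_mul w hadd))).trans (Matrix.det_mul _ _)
  have hM : (Matrix.of fun i j : Fin (N + 1) => (a i ^ 2 + w * a i) ^ ((j : ℕ) + 1) -
      (b i ^ 2 + w * b i) ^ ((j : ℕ) + 1)).det =
      (Matrix.of fun i j => (a i - b i) * Matrix.of e i j).det * _ :=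
    (congrArg Matrix.det ((Matrix.ext fun i j => by
      simp only [Matrix.of_apply, sq_add_mul_pow, ← Finset.sum_sub_distrib, ← mul_sub]).trans
      (of_sum_eq_mul w hsub))).trans (Matrix.det_mul _ _)
  rw [hP, hM, Matrix.det_mul_column]
  ring

theorem prod_filter_lt_eq_prod_Ioi {K : Type*} [CommMonoid K] {n : ℕ} (f : Fin n × Fin n → K) :
    ∏ p ∈ Finset.univ.filter (fun p : Fin n × Fin n => p.1 < p.2), f p =
      ∏ i, ∏ j ∈ Finset.Ioi i, f (i, j) := by
  rw [Finset.prod_filter, Fintype.prod_prod_type]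
  refine Finset.prod_congr rfl fun i _ => ?_
  rw [← Finset.prod_filter, Finset.filter_lt_eq_Ioi]

theorem prod_Ioi_const {K : Type*} [CommMonoid K] (n : ℕ) (t : K) :
    ∏ i : Fin n, ∏ _j ∈ Finset.Ioi i, t = t ^ n.choose 2 := by
  simp only [Finset.prod_const, Finset.prod_pow_eq_pow_sum, Fin.card_Ioi]
  rw [Fin.sum_univ_eq_sum_range fun i => n - 1 - i, Finset.sum_range_reflect (fun i => i),
    Finset.sum_range_id, Nat.choose_two_right]

theorem prod_prod_eq_prod_diag_mul {K : Type*} [CommMonoid K] {n : ℕ} (f : Fin n → Fin n → K) :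
    ∏ i, ∏ j, f i j = (∏ i, f i i) * ∏ i, ∏ j ∈ Finset.Ioi i, f i j * f j i := by
  have h := Finset.prod_prod_Ioi_mul_eq_prod_prod_off_diag fun i j => f j i
  rw [h, ← Finset.prod_mul_distrib]
  exact Finset.prod_congr rfl fun i _ => Fintype.prod_eq_mul_prod_compl i _

theorem prod_sub_mul_prod_eq {K : Type*} [Field K] {n : ℕ} {u v : K} (hu : u ≠ 0) (hv : v ≠ 0)
    (x : Fin n → K) (hx : ∀ i, x i ≠ 0) :
    (∏ i, (u * x i - v * (x i)⁻¹)) * (∏ i, ∏ j ∈ Finset.Ioi i,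
        ((u * x j + v * (x j)⁻¹ - (u * x i + v * (x i)⁻¹)) *
          (u * x i + v * (x i)⁻¹ - (u * x j + v * (x j)⁻¹)))) =
      ((-1 : K) ^ n * u ^ (n ^ 2 + n.choose 2) * v ^ (-(n.choose 2 : ℤ))) *
        ((∏ p ∈ Finset.univ.filter (fun p : Fin n × Fin n => p.1 < p.2),
          ((x p.2 - x p.1) * (u⁻¹ * v * (x p.2)⁻¹ - u⁻¹ * v * (x p.1)⁻¹))) *
        ∏ i : Fin n, ∏ j : Fin n, (u⁻¹ * v * (x j)⁻¹ - x i)) := by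
  have hdiag : ∏ i, (u * x i - v * (x i)⁻¹) =
      (-u) ^ n * ∏ i, (u⁻¹ * v * (x i)⁻¹ - x i) := by
    rw [← Fin.prod_const, ← Finset.prod_mul_distrib]
    refine Finset.prod_congr rfl fun i _ => ?_
    field_simp
    ring
  have hpair : ∀ i j, (u * x j + v * (x j)⁻¹ - (u * x i + v * (x i)⁻¹)) *
      (u * x i + v * (x i)⁻¹ - (u * x j + v * (x j)⁻¹)) = (u ^ 3 * v⁻¹) *
      (((x j - x i) * (u⁻¹ * v * (x j)⁻¹ - u⁻¹ * v * (x i)⁻¹)) *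
        ((u⁻¹ * v * (x j)⁻¹ - x i) * (u⁻¹ * v * (x i)⁻¹ - x j))) := by
    intro i j
    have := hx i
    have := hx j
    field_simp
    ring
  have hsq : n ^ 2 + n.choose 2 = n + 3 * n.choose 2 := by
    rw [Nat.choose_two_right]
    cases n with
    | zero => rfl
    | succ m =>
      have : 2 ∣ (m + 1) * (m + 1 - 1) := even_iff_two_dvd.mp (Nat.even_mul_pred_self _)
      rw [Nat.add_sub_cancel] at this ⊢
      obtain ⟨t, ht⟩ := this
      rw [ht, Nat.mul_div_cancel_left _ two_pos]
      nlinarith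
  rw [prod_filter_lt_eq_prod_Ioi, prod_prod_eq_prod_diag_mul, hdiag]
  simp only [hpair, Finset.prod_mul_distrib]
  rw [prod_Ioi_const, prod_Ioi_const, hsq, pow_add, pow_mul, zpow_neg, zpow_natCast, neg_pow,
    inv_pow]
  ring

theorem uu_ne_zero (n : ℕ) : uu n ≠ 0 :=
  (map_ne_zero_iff _ (IsFractionRing.injective _ _)).mpr (MvPolynomial.X_ne_zero _)

theorem vv_ne_zero (n : ℕ) : vv n ≠ 0 :=
  (map_ne_zero_iff _ (IsFractionRing.injective _ _)).mpr (MvPolynomial.X_ne_zero _)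

theorem XP_ne_zero {n : ℕ} (i : Fin n) : XP i ≠ 0 :=
  (map_ne_zero_iff _ (IsFractionRing.injective _ _)).mpr (MvPolynomial.X_ne_zero _)

theorem XP_injective (n : ℕ) : Function.Injective (XP : Fin n → Fld n) := fun _ _ h =>
  Sum.inl_injective (MvPolynomial.X_injective (IsFractionRing.injective _ _ h))

theorem uu_mul_XP_mul_XP_ne_vv {n : ℕ} (i j : Fin n) : uu n * XP i * XP j ≠ vv n := by
  intro h
  rw [uu, XP, XP, vv, ← map_mul, ← map_mul] at h
  have h' := congrArg (MvPolynomial.eval (Sum.elim (fun _ => (0 : ℚ)) fun _ => 1))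
    (IsFractionRing.injective _ _ h)
  simp at h'

theorem uu_mul_XP_ne {n : ℕ} (i : Fin n) : uu n * XP i ≠ vv n * (XP i)⁻¹ := fun h =>
  uu_mul_XP_mul_XP_ne_vv i i (by rw [h, inv_mul_cancel_right₀ (XP_ne_zero i)])

theorem uu_mul_XP_add_injective (n : ℕ) :
    Function.Injective fun i : Fin n => uu n * XP i + vv n * (XP i)⁻¹ := by
  intro i j h
  by_contra hij
  have hi := XP_ne_zero i
  have hj := XP_ne_zero j
  have h1 : XP i - XP j ≠ 0 := sub_ne_zero.mpr fun h => hij (XP_injective n h)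
  have h2 := sub_ne_zero.mpr (uu_mul_XP_mul_XP_ne_vv i j)
  apply mul_ne_zero h1 h2
  simp only at h
  field_simp at h
  linear_combination h

theorem hpowSeries_bigArgs_mul_prod (n : ℕ) :
    hpowSeries (bigArgs n) *
      ∏ i : Fin n, ((1 - PowerSeries.C (uu n * XP i) * PowerSeries.X) *
        (1 - PowerSeries.C (vv n * (XP i)⁻¹) * PowerSeries.X)) = 1 := by
  refine Eq.trans ?_ (hpowSeries_mul_prod (bigArgs n))
  rw [bigArgs, List.map_append, List.prod_append, List.map_map, List.map_map,
    Finset.prod_mul_distrib, Fin.prod_univ_def, Fin.prod_univ_def]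
  rfl

end JacobiTrudi

/-- **Lemma 5.1 (1).** For `n ≥ 1`, in `ℚ(u,v,w,X_1,…,X_n)`, with all `h`'s evaluated at
`(u X_1, …, u X_n, v X_1^{−1}, …, v X_n^{−1})`:
the quotient of the product of the two bialternant determinants (with `+` and `−`)
by `∏_{1≤i<j≤n}(X_j − X_i)(u^{−1}vX_j^{−1} − u^{−1}vX_i^{−1}) · ∏_{i,j=1}^n (u^{−1}vX_j^{−1} − X_i)`
equals `((−1)^n u^{n² + C(n,2)} v^{−C(n,2)} / 2)` times the product of the two
Jacobi–Trudi type determinants. -/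
theorem det_product_eq_jacobiTrudi_product (n : ℕ) (hn : 1 ≤ n) :
    ((Matrix.of fun i j : Fin n =>
          ((uu n) ^ 2 * (XP i) ^ 2 + uu n * wP n * XP i) ^ ((j : ℕ) + 1) +
            ((vv n) ^ 2 * ((XP i)⁻¹) ^ 2 + vv n * wP n * (XP i)⁻¹) ^ ((j : ℕ) + 1)).det *
        (Matrix.of fun i j : Fin n =>
          ((uu n) ^ 2 * (XP i) ^ 2 + uu n * wP n * XP i) ^ ((j : ℕ) + 1) -
            ((vv n) ^ 2 * ((XP i)⁻¹) ^ 2 + vv n * wP n * (XP i)⁻¹) ^ ((j : ℕ) + 1)).det) /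
      ((∏ p ∈ Finset.univ.filter (fun p : Fin n × Fin n => p.1 < p.2),
          ((XP p.2 - XP p.1) *
            ((uu n)⁻¹ * vv n * (XP p.2)⁻¹ - (uu n)⁻¹ * vv n * (XP p.1)⁻¹))) *
        ∏ i : Fin n, ∏ j : Fin n, ((uu n)⁻¹ * vv n * (XP j)⁻¹ - XP i)) =
      ((-1 : Fld n) ^ n * uu n ^ (n ^ 2 + n.choose 2) * vv n ^ (-(n.choose 2 : ℤ)) / 2) *
        (Matrix.of fun i j : Fin n =>
          ∑ k ∈ Finset.Icc ((j : ℕ) + 1) (2 * ((j : ℕ) + 1)),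
            (Nat.choose ((j : ℕ) + 1) (k - ((j : ℕ) + 1)) : Fld n) *
              wP n ^ (2 * ((j : ℕ) + 1) - k) *
              (Hn n ((k : ℤ) - ((i : ℕ) + 1) + 1) -
                uu n ^ (n - ((i : ℕ) + 1) + 1) * vv n ^ (n - ((i : ℕ) + 1) + 1) *
                  Hn n ((k : ℤ) + ((i : ℕ) + 1) - 2 * (n : ℤ) - 1))).det *
        (Matrix.of fun i j : Fin n =>
          ∑ k ∈ Finset.Icc ((j : ℕ) + 1) (2 * ((j : ℕ) + 1)),
            (Nat.choose ((j : ℕ) + 1) (k - ((j : ℕ) + 1)) : Fld n) *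
              wP n ^ (2 * ((j : ℕ) + 1) - k) *
              (Hn n ((k : ℤ) + ((i : ℕ) + 1) - (n : ℤ) - 1) +
                uu n ^ (i : ℕ) * vv n ^ (i : ℕ) *
                  Hn n ((k : ℤ) - ((i : ℕ) + 1) - (n : ℤ) + 1))).det := by
  have hu := uu_ne_zero n
  have hv := vv_ne_zero n
  have h2 : (2 : Fld n) ≠ 0 := two_ne_zero
  obtain ⟨N, rfl⟩ := Nat.exists_eq_add_of_le' hn
  have key := det_add_mul_det_sub h2 (c := uu (N + 1) * vv (N + 1)) (wP (N + 1))
    (fun i => by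
      have := XP_ne_zero i
      field_simp) (fun i => mul_ne_zero hu (XP_ne_zero i)) uu_mul_XP_ne
    (uu_mul_XP_add_injective _) (hpowSeries_bigArgs_mul_prod (N + 1))
  have hprod := prod_sub_mul_prod_eq hu hv _ (XP_ne_zero (n := N + 1))
  have hne : (∏ i : Fin (N + 1), (uu (N + 1) * XP i - vv (N + 1) * (XP i)⁻¹)) *
      (∏ i : Fin (N + 1), ∏ j ∈ Finset.Ioi i,
        ((uu (N + 1) * XP j + vv (N + 1) * (XP j)⁻¹ -
            (uu (N + 1) * XP i + vv (N + 1) * (XP i)⁻¹)) *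
          (uu (N + 1) * XP i + vv (N + 1) * (XP i)⁻¹ -
            (uu (N + 1) * XP j + vv (N + 1) * (XP j)⁻¹)))) ≠ 0 := by
    refine mul_ne_zero (Finset.prod_ne_zero_iff.mpr fun i _ => sub_ne_zero.mpr (uu_mul_XP_ne i))
      (Finset.prod_ne_zero_iff.mpr fun i _ => Finset.prod_ne_zero_iff.mpr fun j hj => ?_)
    have hij := (Finset.mem_Ioi.mp hj).ne
    exact mul_ne_zero
      (sub_ne_zero.mpr fun h => hij (uu_mul_XP_add_injective _ h).symm)
      (sub_ne_zero.mpr fun h => hij (uu_mul_XP_add_injective _ h))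
  rw [hprod] at key hne
  rw [div_eq_iff (right_ne_zero_of_mul hne)]
  have hf : ∀ x, uu (N + 1) ^ 2 * x ^ 2 + uu (N + 1) * wP (N + 1) * x =
      (uu (N + 1) * x) ^ 2 + wP (N + 1) * (uu (N + 1) * x) := fun x => by ring
  have hg : ∀ x, vv (N + 1) ^ 2 * x ^ 2 + vv (N + 1) * wP (N + 1) * x =
      (vv (N + 1) * x) ^ 2 + wP (N + 1) * (vv (N + 1) * x) := fun x => by ring
  have hG : ∀ (i : Fin (N + 1)) (k : ℕ),
      Hn (N + 1) ((k : ℤ) - ((i : ℕ) + 1) + 1) -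
        uu (N + 1) ^ (N + 1 - ((i : ℕ) + 1) + 1) * vv (N + 1) ^ (N + 1 - ((i : ℕ) + 1) + 1) *
          Hn (N + 1) ((k : ℤ) + ((i : ℕ) + 1) - 2 * ((N + 1 : ℕ) : ℤ) - 1) =
      hz ((k : ℤ) - (i : ℕ)) (bigArgs (N + 1)) - (uu (N + 1) * vv (N + 1)) ^ (N + 1 - (i : ℕ)) *
        hz ((k : ℤ) - (2 * (N + 1) - (i : ℕ) : ℕ)) (bigArgs (N + 1)) := fun i k => by
    rw [Hn, Hn, ← mul_pow, show N + 1 - ((i : ℕ) + 1) + 1 = N + 1 - i by omega,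
      show (k : ℤ) - ((i : ℕ) + 1) + 1 = k - (i : ℕ) by ring,
      show (k : ℤ) + ((i : ℕ) + 1) - 2 * ((N + 1 : ℕ) : ℤ) - 1 =
        k - (2 * (N + 1) - (i : ℕ) : ℕ) by omega]
  have hG' : ∀ (i : Fin (N + 1)) (k : ℕ),
      Hn (N + 1) ((k : ℤ) + ((i : ℕ) + 1) - ((N + 1 : ℕ) : ℤ) - 1) +
        uu (N + 1) ^ (i : ℕ) * vv (N + 1) ^ (i : ℕ) *
          Hn (N + 1) ((k : ℤ) - ((i : ℕ) + 1) - ((N + 1 : ℕ) : ℤ) + 1) =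
      hz ((k : ℤ) - (N - (i : ℕ) + 1 : ℕ)) (bigArgs (N + 1)) +
        (uu (N + 1) * vv (N + 1)) ^ (i : ℕ) *
          hz ((k : ℤ) - (N + (i : ℕ) + 1 : ℕ)) (bigArgs (N + 1)) := fun i k => by
    rw [Hn, Hn, ← mul_pow,
      show (k : ℤ) + ((i : ℕ) + 1) - ((N + 1 : ℕ) : ℤ) - 1 = k - (N - (i : ℕ) + 1 : ℕ) by omega,
      show (k : ℤ) - ((i : ℕ) + 1) - ((N + 1 : ℕ) : ℤ) + 1 = k - (N + (i : ℕ) + 1 : ℕ) by omega]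
  simp only [hf, hg, hG, hG']
  rw [key]
  ring

end
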